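/- Let t = (t_1,…,t_m) be parameters. Let α, β be germs of holomorphic functions at 0 in the variables (x,y,p,t) such that α and ∂α/∂x vanish at the origin, β lies in the ideal (p) (i.e. β is divisible by p), and β satisfies the equation (1 + ∂α/∂x + p·∂α/∂y)·∂β/∂p − p·(∂α/∂p)·∂β/∂y − (∂α/∂p)·∂β/∂x = p·∂α/∂p. Then β lies in the ideal (p²), i.e. β is divisible by p². (Equivalently, in the expansion β = Σ_{l≥0} β_l·p^l with β_l holomorphic in (x,y,t), one has β_0 = β_1 = 0.) -/

import Mathlib

open Filter Topology

/-- Partial `x`-derivative of a function of `(x,y,p,t) ∈ ℂ³ × ℂᵐ`. -/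
noncomputable def pdxT (m : ℕ) (f : ℂ × ℂ × ℂ × (Fin m → ℂ) → ℂ)
    (z : ℂ × ℂ × ℂ × (Fin m → ℂ)) : ℂ := fderiv ℂ f z (1, 0, 0, 0)

/-- Partial `y`-derivative of a function of `(x,y,p,t) ∈ ℂ³ × ℂᵐ`. -/
noncomputable def pdyT (m : ℕ) (f : ℂ × ℂ × ℂ × (Fin m → ℂ) → ℂ)
    (z : ℂ × ℂ × ℂ × (Fin m → ℂ)) : ℂ := fderiv ℂ f z (0, 1, 0, 0)

/-- Partial `p`-derivative of a function of `(x,y,p,t) ∈ ℂ³ × ℂᵐ`. -/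
noncomputable def pdpT (m : ℕ) (f : ℂ × ℂ × ℂ × (Fin m → ℂ) → ℂ)
    (z : ℂ × ℂ × ℂ × (Fin m → ℂ)) : ℂ := fderiv ℂ f z (0, 0, 1, 0)

namespace FormalMultilinearSeries

variable {𝕜 E F : Type*} [NontriviallyNormedField 𝕜] [NormedAddCommGroup E] [NormedSpace 𝕜 E]
  [NormedAddCommGroup F] [NormedSpace 𝕜 F]

/-- The power series of the quotient of `f - f ∘ π` by a linear form `ℓ` such that
`z - π z = ℓ z • e`, where `f` has power series `q`. -/
noncomputable def hadamardQuotient (q : FormalMultilinearSeries 𝕜 E F) (π : E →L[𝕜] E) (e : E) :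
    FormalMultilinearSeries 𝕜 E F := fun n =>
  ∑ i : Fin (n + 1), ((q (n + 1)).curryMid i e).compContinuousLinearMap
    fun j => if (j : ℕ) < i then π else ContinuousLinearMap.id 𝕜 E

theorem smul_hadamardQuotient_apply (q : FormalMultilinearSeries 𝕜 E F) {π : E →L[𝕜] E} {e z : E}
    {c : 𝕜} (hz : z - π z = c • e) (n : ℕ) :
    c • q.hadamardQuotient π e n (fun _ => z) =
      q (n + 1) (fun _ => z) - q (n + 1) (fun _ => π z) := by
  let v : ℕ → Fin (n + 1) → E := fun k j => if (j : ℕ) < k then π z else z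
  have step (i : Fin (n + 1)) :
      c • q (n + 1) (i.insertNth e fun j => if (j : ℕ) < i then π z else z) =
        q (n + 1) (v i) - q (n + 1) (v (i + 1)) := by
    have h₀ : v i = Function.update (v i) i z := by simp [v]
    have h₁ : v (i + 1) = Function.update (v i) i (π z) := by
      ext1 j
      rcases eq_or_ne j i with rfl | hj
      · simp [v]
      · have : (j : ℕ) ≠ i := fun h => hj (Fin.ext h)
        simp only [v, Function.update_of_ne hj]
        congr 1
        apply propext
        omega
    have h₂ : (i.insertNth e fun j : Fin n => if (j : ℕ) < i then π z else z) =
        Function.update (v i) i e := by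
      ext1 j
      induction j using i.succAboveCases with
      | x => simp
      | p j =>
        simp only [Fin.insertNth_apply_succAbove, Function.update_of_ne (Fin.succAbove_ne i j), v]
        congr 1
        apply propext
        rcases lt_or_ge j.castSucc i with h | h
        · rw [Fin.succAbove_of_castSucc_lt _ _ h]
          simp
        · rw [Fin.succAbove_of_le_castSucc _ _ h]
          have : (i : ℕ) ≤ j := h
          simp only [Fin.val_succ]
          omega
    rw [h₂, ← ContinuousMultilinearMap.map_update_smul, ← hz,
      ContinuousMultilinearMap.map_update_sub, ← h₀, ← h₁]
  have hsum : q.hadamardQuotient π e n (fun _ => z) =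
      ∑ i : Fin (n + 1), q (n + 1) (i.insertNth e fun j => if (j : ℕ) < i then π z else z) := by
    simp only [hadamardQuotient, _root_.sum_apply,
      ContinuousMultilinearMap.compContinuousLinearMap_apply,
      ContinuousMultilinearMap.curryMid_apply]
    refine Finset.sum_congr rfl fun i _ => ?_
    congr 2
    ext1 j
    split_ifs <;> rfl
  rw [hsum, Finset.smul_sum, Finset.sum_congr rfl fun i _ => step i,
    Fin.sum_univ_eq_sum_range (fun k => q (n + 1) (v k) - q (n + 1) (v (k + 1))) (n + 1),
    Finset.sum_range_sub']
  have hv₀ : v 0 = fun _ => z := by simp [v]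
  have hv₁ : v (n + 1) = fun _ => π z := funext fun j => if_pos j.isLt
  rw [hv₀, hv₁]

theorem norm_hadamardQuotient_le (q : FormalMultilinearSeries 𝕜 E F) (π : E →L[𝕜] E) (e : E)
    (n : ℕ) :
    ‖q.hadamardQuotient π e n‖ ≤ (n + 1) * (‖q (n + 1)‖ * ‖e‖ * max 1 ‖π‖ ^ n) := by
  have hterm (i : Fin (n + 1)) : ‖((q (n + 1)).curryMid i e).compContinuousLinearMap
      fun j => if (j : ℕ) < i then π else ContinuousLinearMap.id 𝕜 E‖ ≤
        ‖q (n + 1)‖ * ‖e‖ * max 1 ‖π‖ ^ n := by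
    refine (ContinuousMultilinearMap.norm_compContinuousLinearMap_le _ _).trans ?_
    gcongr
    · exact (((q (n + 1)).curryMid i).le_opNorm e).trans_eq
        (by rw [ContinuousMultilinearMap.norm_curryMid])
    · refine (Finset.prod_le_prod (fun _ _ => norm_nonneg _) fun j _ =>
        (?_ : _ ≤ max 1 ‖π‖)).trans_eq (by simp)
      split_ifs
      · exact le_max_right _ _
      · exact ContinuousLinearMap.norm_id_le.trans (le_max_left _ _)
  exact (norm_sum_le_of_le _ fun i _ => hterm i).trans_eq (by simp)

theorem radius_hadamardQuotient_pos {q : FormalMultilinearSeries 𝕜 E F} (hq : 0 < q.radius)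
    (π : E →L[𝕜] E) (e : E) : 0 < (q.hadamardQuotient π e).radius := by
  obtain ⟨C, a, hC, ha, h⟩ := q.le_mul_pow_of_radius_pos hq
  set K := max 1 ‖π‖
  have hK : 0 < K := lt_max_of_lt_left one_pos
  have hr : 0 < (2 * a * K)⁻¹ := by positivity
  lift (2 * a * K)⁻¹ to NNReal using hr.le with r hr'
  have key : ∀ n, ‖q.hadamardQuotient π e n‖ * (r : ℝ) ^ n ≤ C * a * ‖e‖ := fun n => by
    have hn : (n + 1 : ℝ) ≤ 2 ^ n := by exact_mod_cast Nat.lt_two_pow_self (n := n)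
    calc ‖q.hadamardQuotient π e n‖ * (r : ℝ) ^ n
        ≤ (2 ^ n * (C * a ^ (n + 1) * ‖e‖ * K ^ n)) * (r : ℝ) ^ n := by
          gcongr
          exact (q.norm_hadamardQuotient_le π e n).trans (by gcongr; exact h (n + 1))
      _ = C * a * ‖e‖ * (2 * a * K * r) ^ n := by ring
      _ = C * a * ‖e‖ := by
          rw [hr', mul_inv_cancel₀ (by positivity), one_pow, mul_one]
  exact lt_of_lt_of_le (by exact_mod_cast hr) (le_radius_of_bound _ _ key)

end FormalMultilinearSeries

/-- **Hadamard lemma** for analytic germs: a germ vanishing on the range of the projection `π`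
onto a hyperplane is divisible by the corresponding linear form. -/
theorem AnalyticAt.exists_eventuallyEq_smul_of_comp_eq_zero {𝕜 E F : Type*}
    [NontriviallyNormedField 𝕜] [NormedAddCommGroup E] [NormedSpace 𝕜 E]
    [NormedAddCommGroup F] [NormedSpace 𝕜 F] [CompleteSpace F] {f : E → F}
    (hf : AnalyticAt 𝕜 f 0) (ℓ : E → 𝕜) (π : E →L[𝕜] E) (e : E)
    (hπ : ∀ z, z - π z = ℓ z • e) (hz : ∀ᶠ z in 𝓝 0, f (π z) = 0) :
    ∃ g : E → F, AnalyticAt 𝕜 g 0 ∧ ∀ᶠ z in 𝓝 0, f z = ℓ z • g z := by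
  obtain ⟨q, hq⟩ := hf
  have hr := q.radius_hadamardQuotient_pos hq.radius_pos π e
  have hg := (q.hadamardQuotient π e).hasFPowerSeriesOnBall hr
  refine ⟨_, hg.analyticAt, ?_⟩
  have hπ0 : Tendsto π (𝓝 0) (𝓝 0) := by simpa using π.continuous.tendsto 0
  filter_upwards [hz, hq.eventually_hasSum, hπ0.eventually hq.eventually_hasSum,
    hg.hasFPowerSeriesAt.eventually_hasSum] with z h₀ h₁ h₂ h₃
  simp only [zero_add] at h₁ h₂ h₃
  have h₄ := h₃.const_smul (ℓ z)
  simp only [q.smul_hadamardQuotient_apply (hπ z)] at h₄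
  have h₅ := (hasSum_nat_add_iff' 1).2 (h₁.sub h₂)
  have h₆ : q 0 (fun _ => z) = q 0 (fun _ => π z) := congrArg _ (Subsingleton.elim _ _)
  simp only [Finset.sum_range_one, h₆, sub_self, sub_zero, h₀] at h₅
  exact h₅.unique h₄

/-- Let `t = (t_1,…,t_m)` be parameters and let `α, β` be holomorphic
germs at `0` in `(x,y,p,t)` such that `α` and `∂α/∂x` vanish at the origin, `β` is
divisible by `p`, and `β` satisfies
`(1 + ∂α/∂x + p·∂α/∂y)·∂β/∂p − p·(∂α/∂p)·∂β/∂y − (∂α/∂p)·∂β/∂x = p·∂α/∂p`.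
Then `β` is divisible by `p²`. -/
theorem stmt1 (m : ℕ) (α β : ℂ × ℂ × ℂ × (Fin m → ℂ) → ℂ)
    (hα : AnalyticAt ℂ α 0) (hβ : AnalyticAt ℂ β 0)
    (hα0 : α 0 = 0) (hαx : pdxT m α 0 = 0)
    (hβp : ∃ h : ℂ × ℂ × ℂ × (Fin m → ℂ) → ℂ, AnalyticAt ℂ h 0 ∧
      ∀ᶠ z in 𝓝 (0 : ℂ × ℂ × ℂ × (Fin m → ℂ)), β z = z.2.2.1 * h z)
    (hpde : ∀ᶠ z in 𝓝 (0 : ℂ × ℂ × ℂ × (Fin m → ℂ)),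
      (1 + pdxT m α z + z.2.2.1 * pdyT m α z) * pdpT m β z
        - z.2.2.1 * pdpT m α z * pdyT m β z - pdpT m α z * pdxT m β z
        = z.2.2.1 * pdpT m α z) :
    ∃ h : ℂ × ℂ × ℂ × (Fin m → ℂ) → ℂ, AnalyticAt ℂ h 0 ∧
      ∀ᶠ z in 𝓝 (0 : ℂ × ℂ × ℂ × (Fin m → ℂ)), β z = z.2.2.1 ^ 2 * h z := by
  obtain ⟨h, hh, hβh⟩ := hβp
  let P : ℂ × ℂ × ℂ × (Fin m → ℂ) →L[ℂ] ℂ := ContinuousLinearMap.fst ℂ ℂ (Fin m → ℂ) ∘L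
    ContinuousLinearMap.snd ℂ ℂ (ℂ × (Fin m → ℂ)) ∘L
      ContinuousLinearMap.snd ℂ ℂ (ℂ × ℂ × (Fin m → ℂ))
  have hne : ∀ᶠ z in 𝓝 (0 : ℂ × ℂ × ℂ × (Fin m → ℂ)), 1 + pdxT m α z ≠ 0 := by
    have hc : ContinuousAt (fun z => 1 + pdxT m α z) 0 :=
      continuousAt_const.add (hα.fderiv.continuousAt.clm_apply continuousAt_const)
    exact hc.eventually_ne (by simp [hαx])
  have hvan : ∀ᶠ z in 𝓝 (0 : ℂ × ℂ × ℂ × (Fin m → ℂ)), z.2.2.1 = 0 → h z = 0 := by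
    filter_upwards [hne, hpde, hβh.eventually_nhds, hh.eventually_analyticAt]
      with z hz hpz hβz hhz hp
    have hd : fderiv ℂ β z = h z • P := by
      rw [EventuallyEq.fderiv_eq hβz]
      have := P.hasFDerivAt.mul (hhz.differentiableAt.hasFDerivAt (x := z))
      have hPz : P z = 0 := hp
      refine this.fderiv.trans ?_
      refine ContinuousLinearMap.ext fun v => ?_
      change P z * fderiv ℂ h z v + h z * P v = h z * P v
      rw [hPz, zero_mul, zero_add]
    have hx : pdxT m β z = 0 := by simp [pdxT, hd, P]
    have hpβ : pdpT m β z = h z := by simp [pdpT, hd, P]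
    simpa [hx, hpβ, hp, hz] using hpz
  let e : ℂ × ℂ × ℂ × (Fin m → ℂ) := (0, 0, 1, 0)
  let π : ℂ × ℂ × ℂ × (Fin m → ℂ) →L[ℂ] ℂ × ℂ × ℂ × (Fin m → ℂ) :=
    ContinuousLinearMap.id ℂ _ - P.smulRight e
  have hπ0 : Tendsto π (𝓝 0) (𝓝 0) := by simpa using π.continuous.tendsto 0
  obtain ⟨k, hk, hhk⟩ := hh.exists_eventuallyEq_smul_of_comp_eq_zero P π e (by simp [π])
    ((hπ0.eventually hvan).mono fun z hz => hz (by simp [π, P, e]))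
  refine ⟨k, hk, ?_⟩
  filter_upwards [hβh, hhk] with z h₁ h₂
  rw [h₁, h₂, smul_eq_mul, pow_two, mul_assoc]
  rfl
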